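/- Let A and Â be non-negative, self-adjoint, trace-class operators on a separable Hilbert space H, with eigenvalues λ₁ ≥ λ₂ ≥ ... of A satisfying λ_r > λ_{r+1}, and let P̂_r be the orthogonal projection onto the span of the top r eigenvectors of Â. Then Tr(A(I − P̂_r)) ≤ ∑_{i=r+1}^∞ λ_i + 2‖A − Â‖²_{HS} / (λ_r − λ_{r+1}). -/

import Mathlib

open RealInnerProductSpace

/-- Parseval's identity for a Hilbert basis of a real Hilbert space. -/
theorem HilbertBasis.hasSum_real_inner_sq {ι H : Type*} [NormedAddCommGroup H]
    [InnerProductSpace ℝ H] (b : HilbertBasis ι ℝ H) (x : H) :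
    HasSum (fun j => ⟪b j, x⟫ ^ 2) (‖x‖ ^ 2) := by
  have h := b.hasSum_inner_mul_inner x x
  rw [real_inner_self_eq_norm_sq] at h
  refine h.congr_fun ?_
  intro j
  rw [real_inner_comm x (b j), sq]

/-- An operator diagonalized by a Hilbert basis with square-summable eigenvalues is
Hilbert–Schmidt with respect to every other Hilbert basis. -/
theorem HilbertBasis.summable_norm_sq_of_diagonal {ι κ H : Type*} [NormedAddCommGroup H]
    [InnerProductSpace ℝ H] [CompleteSpace H] (b : HilbertBasis ι ℝ H) (e : HilbertBasis κ ℝ H)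
    (T : H →L[ℝ] H) (hT : IsSelfAdjoint T) (μ : ι → ℝ) (heig : ∀ i, T (b i) = μ i • b i)
    (hμ : Summable fun i => μ i ^ 2) :
    Summable fun k => ‖T (e k)‖ ^ 2 := by
  have hrow (k : κ) : HasSum (fun j => μ j ^ 2 * ⟪b j, e k⟫ ^ 2) (‖T (e k)‖ ^ 2) := by
    refine (b.hasSum_real_inner_sq (T (e k))).congr_fun fun j => ?_
    have h := hT.isSymmetric (b j) (e k)
    simp only [ContinuousLinearMap.coe_coe] at h
    rw [← h, heig, real_inner_smul_left, mul_pow]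
  have hcol (j : ι) : HasSum (fun k => μ j ^ 2 * ⟪b j, e k⟫ ^ 2) (μ j ^ 2) := by
    have h := (e.hasSum_real_inner_sq (b j)).mul_left (μ j ^ 2)
    rw [b.orthonormal.1 j, one_pow, mul_one] at h
    refine h.congr_fun fun k => ?_
    rw [real_inner_comm]
  have hprod : Summable fun p : ι × κ => μ p.1 ^ 2 * ⟪b p.1, e p.2⟫ ^ 2 := by
    refine (summable_prod_of_nonneg fun p => by positivity).2 ⟨fun j => (hcol j).summable, ?_⟩
    simpa only [(hcol _).tsum_eq] using hμ
  have hswap := hprod.prod_symm.prod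
  simpa only [Prod.swap, (hrow _).tsum_eq] using hswap

/-- Let `A` and `Ahat` be non-negative, self-adjoint, trace-class operators on a separable
Hilbert space `H`, with Hilbert bases `u`, `uh` of eigenvectors and decreasing summable
eigenvalue sequences `lam`, `lamh` (0-indexed, so the 1-based `λ_r` is `lam (r-1)` and
`λ_{r+1}` is `lam r`).  Assume the spectral gap `lam (r-1) > lam r` (i.e. `λ_r > λ_{r+1}`),
with `0 < r`.  For `Phat` the orthogonal projection onto the span of the top `r` eigenvectors
of `Ahat`, the trace `Tr(A (I - Phat))` is bounded by the tail sum `∑_{i≥r} lam i` plus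
`2 ‖A - Ahat‖²_HS / (λ_r - λ_{r+1})`. -/
theorem stmt_3 {H : Type*} [NormedAddCommGroup H] [InnerProductSpace ℝ H] [CompleteSpace H]
    (A Ahat : H →L[ℝ] H) (hA : IsSelfAdjoint A) (hAhat : IsSelfAdjoint Ahat)
    (hposA : ∀ x : H, 0 ≤ ⟪A x, x⟫) (hposAhat : ∀ x : H, 0 ≤ ⟪Ahat x, x⟫)
    (lam lamh : ℕ → ℝ) (u uh : HilbertBasis ℕ ℝ H)
    (heigA : ∀ i, A (u i) = lam i • u i) (heigAh : ∀ i, Ahat (uh i) = lamh i • uh i)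
    (hdecA : Antitone lam) (hdecAh : Antitone lamh)
    (htcA : Summable lam) (htcAh : Summable lamh)
    (r : ℕ) (hr : 0 < r) (hgap : lam r < lam (r - 1))
    (Phat : H →L[ℝ] H)
    (hPhat : Phat = ∑ i : Fin r, (innerSL ℝ (uh (i : ℕ))).smulRight (uh (i : ℕ))) :
    (∑' i, ⟪(A ∘L ((1 : H →L[ℝ] H) - Phat)) (u i), u i⟫)
      ≤ (∑' i, lam (i + r))
        + 2 * (∑' i, ‖(A - Ahat) (u i)‖ ^ 2) / (lam (r - 1) - lam r) := by
  set c := lamh (r - 1)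
  set M := (lam (r - 1) + lam r) / 2 with hM
  set h := (lam (r - 1) - lam r) / 2 with hh
  have hh0 : 0 < h := by rw [hh]; linarith
  set k := M - 2 * c with hk
  have hlam (i : ℕ) : 0 ≤ lam i := by
    have := hposA (u i)
    rwa [heigA, real_inner_smul_left, real_inner_self_eq_norm_sq, u.orthonormal.1 i, one_pow,
      mul_one] at this
  have hlamh (i : ℕ) : 0 ≤ lamh i := by
    have := hposAhat (uh i)
    rwa [heigAh, real_inner_smul_left, real_inner_self_eq_norm_sq, uh.orthonormal.1 i, one_pow,
      mul_one] at this
  have sqs {f : ℕ → ℝ} (hf0 : ∀ i, 0 ≤ f i) (hdec : Antitone f) (hf : Summable f) :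
      Summable fun i => f i ^ 2 := by
    refine Summable.of_nonneg_of_le (fun i => sq_nonneg _) (fun i => ?_) (hf.mul_left (f 0))
    rw [sq]
    exact mul_le_mul_of_nonneg_right (hdec (Nat.zero_le i)) (hf0 i)
  have hA2 : Summable fun i => ‖A (u i)‖ ^ 2 :=
    u.summable_norm_sq_of_diagonal u A hA lam heigA (sqs hlam hdecA htcA)
  have hAh2 : Summable fun i => ‖Ahat (u i)‖ ^ 2 :=
    uh.summable_norm_sq_of_diagonal u Ahat hAhat lamh heigAh (sqs hlamh hdecAh htcAh)
  have hD : Summable fun i => ‖(A - Ahat) (u i)‖ ^ 2 := by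
    refine Summable.of_nonneg_of_le (fun i => sq_nonneg _) (fun i => ?_)
      ((hA2.add hAh2).mul_left 2)
    rw [sub_apply]
    have h1 := norm_sub_le (A (u i)) (Ahat (u i))
    have h2 := norm_nonneg (A (u i) - Ahat (u i))
    nlinarith [sq_nonneg (‖A (u i)‖ - ‖Ahat (u i)‖)]
  set p : ℕ → ℕ → ℝ := fun i j => ⟪uh j, u i⟫ ^ 2 with hp
  have hp0 (i j : ℕ) : 0 ≤ p i j := sq_nonneg _
  have hprow (i : ℕ) : HasSum (p i) 1 := by
    have := uh.hasSum_real_inner_sq (u i)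
    rwa [u.orthonormal.1 i, one_pow] at this
  have hpcol (j : ℕ) : HasSum (fun i => p i j) 1 := by
    have := u.hasSum_real_inner_sq (uh j)
    rw [uh.orthonormal.1 j, one_pow] at this
    refine this.congr_fun fun i => ?_
    rw [hp, real_inner_comm]
  have hDrow (i : ℕ) :
      HasSum (fun j => (lam i - lamh j) ^ 2 * p i j) (‖(A - Ahat) (u i)‖ ^ 2) := by
    refine (uh.hasSum_real_inner_sq ((A - Ahat) (u i))).congr_fun fun j => ?_
    have := hAhat.isSymmetric (uh j) (u i)
    simp only [ContinuousLinearMap.coe_coe] at this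
    rw [sub_apply, inner_sub_right, ← this, heigA, heigAh,
      real_inner_smul_left, real_inner_smul_right, ← sub_mul, mul_pow]
  set s : ℕ → ℝ := fun i => ∑ j ∈ Finset.range r, p i j with hs
  have hs0 (i : ℕ) : 0 ≤ s i := Finset.sum_nonneg fun j _ => hp0 i j
  have hssum : HasSum s r := by
    have := hasSum_sum (s := Finset.range r) fun j _ => hpcol j
    simpa using this
  have hlams : Summable fun i => lam i * s i :=
    Summable.of_nonneg_of_le (fun i => mul_nonneg (hlam i) (hs0 i))
      (fun i => mul_le_mul_of_nonneg_right (hdecA (Nat.zero_le i)) (hs0 i))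
      (hssum.summable.mul_left (lam 0))
  have hterm (i : ℕ) :
      ⟪(A ∘L ((1 : H →L[ℝ] H) - Phat)) (u i), u i⟫ = lam i - lam i * s i := by
    have h1 := hA.isSymmetric (((1 : H →L[ℝ] H) - Phat) (u i)) (u i)
    simp only [ContinuousLinearMap.coe_coe] at h1
    rw [ContinuousLinearMap.comp_apply, h1, heigA, real_inner_smul_right,
      sub_apply, inner_sub_left, one_apply_eq_self, real_inner_self_eq_norm_sq,
      u.orthonormal.1 i, hPhat]
    have h2 : ⟪(∑ i : Fin r, (innerSL ℝ (uh (i : ℕ))).smulRight (uh (i : ℕ))) (u i), u i⟫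
        = s i := by
      rw [sum_apply, sum_inner]
      simp only [hs]
      rw [← Fin.sum_univ_eq_sum_range (fun j => p i j) r]
      refine Finset.sum_congr rfl fun j _ => ?_
      rw [ContinuousLinearMap.smulRight_apply, innerSL_apply_apply, real_inner_smul_left]
      exact (sq _).symm
    rw [h2]
    ring
  have hrowle (i : ℕ) :
      (lam i + k) * ((if i < r then 1 else 0) - s i) ≤ ‖(A - Ahat) (u i)‖ ^ 2 / h := by
    have hfin : HasSum (fun j => if j < r then p i j else 0) (s i) := by
      have := hasSum_sum_of_ne_finset_zero (L := .unconditional ℕ)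
        (f := fun j => if j < r then p i j else 0)
        (s := Finset.range r) (fun j hj => if_neg (by simpa using hj))
      convert this using 1
      exact Finset.sum_congr rfl fun j hj => (if_pos (Finset.mem_range.1 hj)).symm
    have hL := (((hprow i).mul_right (if i < r then (1 : ℝ) else 0)).sub hfin).mul_left (lam i + k)
    rw [one_mul] at hL
    refine hasSum_le (fun j => ?_) hL ((hDrow i).div_const h)
    have key : (lam i + k) * ((if i < r then 1 else 0) - (if j < r then 1 else 0))
        ≤ (lam i - lamh j) ^ 2 / h := by
      rw [le_div_iff₀ hh0]
      have hsq := sq_nonneg (lam i - lamh j)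
      by_cases hi : i < r <;> by_cases hj : j < r
      · simpa [hi, hj] using hsq
      · have h1 : lam (r - 1) ≤ lam i := hdecA (by omega)
        have h2 : lamh j ≤ c := hdecAh (by omega)
        simp only [hi, hj, if_true, if_false, sub_zero, mul_one]
        have h3 : lam i + k ≤ 2 * (lam i - lamh j) - h := by linarith
        nlinarith [sq_nonneg (lam i - lamh j - h)]
      · have h1 : lam i ≤ lam r := hdecA (by omega)
        have h2 : c ≤ lamh j := hdecAh (by omega)
        simp only [hi, hj, if_true, if_false, zero_sub, mul_neg, mul_one]
        have h3 : -(lam i + k) ≤ 2 * (lamh j - lam i) - h := by linarith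
        nlinarith [sq_nonneg (lamh j - lam i - h)]
      · simpa [hi, hj] using hsq
    calc _ = (lam i + k) * ((if i < r then 1 else 0) - (if j < r then 1 else 0)) * p i j := by
          split_ifs <;> ring
      _ ≤ (lam i - lamh j) ^ 2 / h * p i j := mul_le_mul_of_nonneg_right key (hp0 i j)
      _ = _ := by ring
  have hhead : HasSum (fun i => (lam i + k) * (if i < r then (1 : ℝ) else 0))
      (∑ i ∈ Finset.range r, (lam i + k)) := by
    have := hasSum_sum_of_ne_finset_zero (L := .unconditional ℕ)
      (f := fun i => (lam i + k) * (if i < r then (1 : ℝ) else 0))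
      (s := Finset.range r) (fun i hi => by simp [Finset.mem_range.not.1 hi])
    convert this using 1
    exact Finset.sum_congr rfl fun i hi => by simp [Finset.mem_range.1 hi]
  have hsumL := hhead.sub (hlams.hasSum.add (hssum.mul_left k))
  have hmain := hasSum_le (fun i => ?_) hsumL (hD.hasSum.div_const h)
  · have htail := htcA.sum_add_tsum_nat_add r
    rw [Finset.sum_add_distrib, Finset.sum_const, Finset.card_range, nsmul_eq_mul] at hmain
    have h2 : 2 * (∑' i, ‖(A - Ahat) (u i)‖ ^ 2) / (lam (r - 1) - lam r)
        = (∑' i, ‖(A - Ahat) (u i)‖ ^ 2) / h := by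
      rw [hh, div_div_eq_mul_div, mul_comm]
    rw [h2, tsum_congr hterm, htcA.tsum_sub hlams]
    linarith
  · refine le_trans (le_of_eq ?_) (hrowle i)
    ring
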